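/- Let a : ℝ → ℝ be twice continuously differentiable on [0,1]. Then there exists a constant C > 0 such that for all h ∈ (0,1], the iterated integral satisfies |∫₀ʰ a(t)·(∫₀ᵗ a(s) ds) dt − (1/2)·a(0)·a(h)·h²| ≤ C·h⁴. -/

import Mathlib

theorem integral_mul_integral_eq_half_sq {a : ℝ → ℝ} {h : ℝ} (hh : 0 ≤ h)
    (ha : ContinuousOn a (Set.Icc 0 h)) :
    ∫ t in (0 : ℝ)..h, a t * ∫ s in (0 : ℝ)..t, a s = (∫ t in (0 : ℝ)..h, a t) ^ 2 / 2 := by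
  set b : ℝ → ℝ := Set.IccExtend hh ((Set.Icc 0 h).domRestrict a) with hb
  have hbc : Continuous b := ha.domRestrict.Icc_extend'
  have hab : ∀ t ∈ Set.Icc 0 h, a t = b t := fun t ht => by
    rw [hb, Set.IccExtend_of_mem _ _ ht, Set.domRestrict_apply]
  have hint : ∀ t ∈ Set.Icc 0 h, ∫ s in (0 : ℝ)..t, a s = ∫ s in (0 : ℝ)..t, b s := by
    intro t ht
    refine intervalIntegral.integral_congr fun s hs => ?_
    rw [Set.uIcc_of_le ht.1] at hs
    exact hab s ⟨hs.1, hs.2.trans ht.2⟩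
  have hdouble : ∫ t in (0 : ℝ)..h, a t * ∫ s in (0 : ℝ)..t, a s =
      ∫ t in (0 : ℝ)..h, b t * ∫ s in (0 : ℝ)..t, b s := by
    refine intervalIntegral.integral_congr fun t ht => ?_
    rw [Set.uIcc_of_le hh] at ht
    simp only [hint t ht, hab t ht]
  have hderiv : ∀ t, HasDerivAt (fun u => ∫ s in (0 : ℝ)..u, b s) (b t) t := fun t =>
    (hbc.integral_hasStrictDerivAt 0 t).hasDerivAt
  have hprim : Continuous fun u => ∫ s in (0 : ℝ)..u, b s :=
    continuous_iff_continuousAt.2 fun t => (hderiv t).continuousAt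
  rw [hdouble, hint h ⟨hh, le_rfl⟩, intervalIntegral.integral_eq_sub_of_hasDerivAt
    (f := fun u => (∫ s in (0 : ℝ)..u, b s) ^ 2 / 2)
    (f' := fun t => b t * ∫ s in (0 : ℝ)..t, b s)
    (fun t _ => (((hderiv t).pow 2).div_const 2).congr_deriv (by ring))
    ((hbc.mul hprim).intervalIntegrable _ _)]
  simp

theorem ContDiffOn.exists_abs_sub_affine_le {a : ℝ → ℝ} (ha : ContDiffOn ℝ 2 a (Set.Icc 0 1)) :
    ∃ c K : ℝ, 0 < K ∧ ∀ t ∈ Set.Icc (0 : ℝ) 1, |a t - (a 0 + c * t)| ≤ K * t ^ 2 := by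
  obtain ⟨C, hC⟩ := exists_taylor_mean_remainder_bound (n := 1) zero_le_one
    (by norm_num; exact ha)
  refine ⟨derivWithin a (Set.Icc 0 1) 0, |C| + 1, by positivity, fun t ht => ?_⟩
  have h := hC t ht
  rw [taylorWithinEval_succ, taylor_within_zero_eval, iteratedDerivWithin_one] at h
  norm_num at h
  rw [mul_comm t] at h
  exact h.trans (by gcongr; exact (le_abs_self C).trans (by linarith))

theorem abs_integral_sub_affine_le {a : ℝ → ℝ} {α c K h : ℝ} (hh : 0 ≤ h) (hK : 0 ≤ K)
    (ha : ContinuousOn a (Set.Icc 0 h))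
    (hbound : ∀ t ∈ Set.Icc 0 h, |a t - (α + c * t)| ≤ K * t ^ 2) :
    |(∫ t in (0 : ℝ)..h, a t) - (α * h + c * h ^ 2 / 2)| ≤ K * h ^ 3 := by
  have haffine : ∫ t in (0 : ℝ)..h, (α + c * t) = α * h + c * h ^ 2 / 2 := by
    rw [intervalIntegral.integral_add (by simp)
      (Continuous.intervalIntegrable (by fun_prop) _ _)]
    rw [intervalIntegral.integral_const_mul, integral_id, intervalIntegral.integral_const]
    simp
    ring
  rw [← haffine, ← intervalIntegral.integral_sub (ha.intervalIntegrable_of_Icc hh)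
    (Continuous.intervalIntegrable (by fun_prop) _ _)]
  have hle := intervalIntegral.norm_integral_le_of_norm_le_const (a := 0) (b := h)
    (f := fun t => a t - (α + c * t)) (C := K * h ^ 2) fun t ht => by
      rw [Set.uIoc_of_le hh] at ht
      have ht0 := ht.1.le
      exact (hbound t ⟨ht0, ht.2⟩).trans (by gcongr; exact ht.2)
  rw [Real.norm_eq_abs, sub_zero, abs_of_nonneg hh] at hle
  exact hle.trans_eq (by ring)

theorem abs_half_sq_sub_le {α c K h A β : ℝ} (h0 : 0 < h) (h1 : h ≤ 1)
    (hA : |A - (α * h + c * h ^ 2 / 2)| ≤ K * h ^ 3) (hβ : |β - (α + c * h)| ≤ K * h ^ 2) :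
    |A ^ 2 / 2 - (1 / 2) * α * β * h ^ 2| ≤
      (c ^ 2 / 8 + K ^ 2 / 2 + |α| * K + |c| * K / 2 + |α| * K / 2) * h ^ 4 := by
  obtain ⟨e, he⟩ : ∃ e, A - (α * h + c * h ^ 2 / 2) = e * h ^ 3 :=
    ⟨_, (div_mul_cancel₀ _ (by positivity)).symm⟩
  obtain ⟨r, hr⟩ : ∃ r, β - (α + c * h) = r * h ^ 2 :=
    ⟨_, (div_mul_cancel₀ _ (by positivity)).symm⟩
  rw [he, abs_mul, abs_of_pos (pow_pos h0 3), mul_le_mul_iff_left₀ (by positivity)] at hA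
  rw [hr, abs_mul, abs_of_pos (pow_pos h0 2), mul_le_mul_iff_left₀ (by positivity)] at hβ
  have hK : 0 ≤ K := (abs_nonneg e).trans hA
  have hexpand : A ^ 2 / 2 - (1 / 2) * α * β * h ^ 2 =
      (c ^ 2 / 8 + (e * h) ^ 2 / 2 + α * e + c * (e * h) / 2 - α * r / 2) * h ^ 4 := by
    rw [sub_eq_iff_eq_add.1 he, sub_eq_iff_eq_add.1 hr]
    ring
  rw [hexpand, abs_mul, abs_of_pos (pow_pos h0 4)]
  gcongr
  have heh : |e * h| ≤ K := by
    rw [abs_mul, abs_of_pos h0]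
    exact (mul_le_of_le_one_right (abs_nonneg e) h1).trans hA
  have hsq : (e * h) ^ 2 ≤ K ^ 2 := sq_le_sq' (neg_le_of_abs_le heh) (le_of_abs_le heh)
  have hαe : |α * e| ≤ |α| * K := by rw [abs_mul]; gcongr
  have hαr : |α * r| ≤ |α| * K := by rw [abs_mul]; gcongr
  have hce : |c * (e * h)| ≤ |c| * K := by rw [abs_mul]; gcongr
  rw [abs_le] at hαe hαr hce ⊢
  constructor <;> linarith [sq_nonneg c, sq_nonneg (e * h), sq_nonneg K]

theorem stmt_10 (a : ℝ → ℝ) (ha : ContDiffOn ℝ 2 a (Set.Icc 0 1)) :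
    ∃ C > 0, ∀ h ∈ Set.Ioc (0 : ℝ) 1,
      |(∫ t in (0 : ℝ)..h, a t * ∫ s in (0 : ℝ)..t, a s)
          - (1 / 2) * a 0 * a h * h ^ 2| ≤ C * h ^ 4 := by
  obtain ⟨c, K, hK, hbound⟩ := ha.exists_abs_sub_affine_le
  refine ⟨c ^ 2 / 8 + K ^ 2 / 2 + |a 0| * K + |c| * K / 2 + |a 0| * K / 2, by positivity, ?_⟩
  rintro h ⟨h0, h1⟩
  have hsub : Set.Icc 0 h ⊆ Set.Icc (0 : ℝ) 1 := Set.Icc_subset_Icc_right h1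
  have hcont := ha.continuousOn.mono hsub
  rw [integral_mul_integral_eq_half_sq h0.le hcont]
  exact abs_half_sq_sub_le h0 h1
    (abs_integral_sub_affine_le h0.le hK.le hcont fun t ht => hbound t (hsub ht))
    (hbound h ⟨h0.le, h1⟩)
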